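/- arXiv:1304.4517 — 4 statements merged into one kernel-verified Lean document; each statement's English description precedes it below -/
import Mathlib

section
/- Let N > 0 and ω ∈ [−N/2, N/2). Let 0 < ε_0 < ε_1 < ⋯ < ε_m be real numbers and b_0, b_1, …, b_m ∈ ℝ be such that ‖ε_j ω − b_j‖_ℤ < δ for all 0 ≤ j ≤ m, where 0 < δ ≤ 1/4. Assume that ε_0 ≤ (1 − 2δ)/N and that β_j := ε_j/ε_{j−1} ≤ (1 − 2δ)/(2δ) for 1 ≤ j ≤ m. Define recursively λ_0 = (b_0 mod [−1/2, 1/2))/ε_0 and, for 1 ≤ j ≤ m, λ_j = ((b_j − ε_j(λ_0 + ⋯ + λ_{j−1})) mod [−1/2, 1/2))/ε_j. Then the estimate ω̃ := λ_0 + λ_1 + ⋯ + λ_m satisfies |ω̃ − ω| ≤ (δ/ε_0) · ∏_{j=1}^m β_j^{−1}. -/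
/-- The Lee norm of `x`: the distance from `x` to the nearest integer. -/
noncomputable def leeNorm (x : ℝ) : ℝ := ⨅ k : ℤ, |x - (k : ℝ)|

/-- `x mod [-1/2, 1/2)`: the unique `y ∈ [-1/2, 1/2)` with `x - y ∈ ℤ`. -/
noncomputable def modHalf (x : ℝ) : ℝ := Int.fract (x + 1/2) - 1/2

/-- Rounding to `[-1/2, 1/2)` recovers `y` up to the Lee error of `c`, provided `y` keeps
distance `δ` from the boundary. -/
theorem abs_modHalf_sub_lt {y c δ : ℝ} (hy : |y| ≤ (1 - 2 * δ) / 2) (hc : leeNorm (y - c) < δ) :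
    |modHalf c - y| < δ := by
  obtain ⟨k, hk⟩ := exists_lt_of_ciInf_lt hc
  rw [abs_lt] at hk
  rw [abs_le] at hy
  have hfract : Int.fract (c + 1 / 2) = c + 1 / 2 + k := by
    rw [← Int.fract_add_intCast (c + 1 / 2) k, Int.fract_eq_self]
    constructor <;> linarith
  rw [modHalf, hfract, abs_lt]
  constructor <;> linarith

/-- A telescoping product of inverse ratios. -/
theorem div_mul_prod_ratio_inv (δ : ℝ) (ε : ℕ → ℝ) (m : ℕ) (hε : ∀ j ≤ m, ε j ≠ 0) :
    δ / ε 0 * ∏ j ∈ Finset.Icc 1 m, (ε j / ε (j - 1))⁻¹ = δ / ε m := by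
  induction m with
  | zero => simp
  | succ n ih =>
    rw [Finset.prod_Icc_succ_top (by omega), ← mul_assoc, ih fun j hj => hε j (by omega)]
    have h₁ := hε n (by omega)
    have h₂ := hε (n + 1) le_rfl
    simp only [Nat.add_sub_cancel]
    field_simp

/-- Theorem 4.2: multiscale frequency estimation. Let `N > 0`, `ω ∈ [-N/2, N/2)`,
`0 < ε 0 < ε 1 < ⋯ < ε m`, and `b 0, …, b m ∈ ℝ` with `‖ε j * ω - b j‖_ℤ < δ` for
all `0 ≤ j ≤ m`, where `0 < δ ≤ 1/4`. Assume `ε 0 ≤ (1 - 2δ)/N` and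
`β j := ε j / ε (j-1) ≤ (1 - 2δ)/(2δ)` for `1 ≤ j ≤ m`. With
`λ 0 = (b 0 mod [-1/2,1/2))/ε 0` and
`λ j = ((b j - ε j * (λ 0 + ⋯ + λ (j-1))) mod [-1/2,1/2))/ε j` for `1 ≤ j ≤ m`,
the estimate `ω̃ = λ 0 + ⋯ + λ m` satisfies
`|ω̃ - ω| ≤ (δ/ε 0) * ∏_{j=1}^m (β j)⁻¹`. -/
theorem multiscale_estimate (N : ℝ) (hN : 0 < N) (ω : ℝ)
    (hω₁ : -(N/2) ≤ ω) (hω₂ : ω < N/2)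
    (m : ℕ) (ε b : ℕ → ℝ)
    (hε₀ : 0 < ε 0)
    (hεmono : ∀ j, 1 ≤ j → j ≤ m → ε (j - 1) < ε j)
    (δ : ℝ) (hδ₀ : 0 < δ) (hδ₁ : δ ≤ 1/4)
    (hb : ∀ j ≤ m, leeNorm (ε j * ω - b j) < δ)
    (hε₀N : ε 0 ≤ (1 - 2 * δ) / N)
    (hβ : ∀ j, 1 ≤ j → j ≤ m → ε j / ε (j - 1) ≤ (1 - 2 * δ) / (2 * δ))
    (lam : ℕ → ℝ)
    (hlam₀ : lam 0 = modHalf (b 0) / ε 0)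
    (hlam : ∀ j, 1 ≤ j → j ≤ m →
      lam j = modHalf (b j - ε j * ∑ i ∈ Finset.range j, lam i) / ε j) :
    |(∑ j ∈ Finset.range (m + 1), lam j) - ω| ≤
      (δ / ε 0) * ∏ j ∈ Finset.Icc 1 m, (ε j / ε (j - 1))⁻¹ := by
  have hpos : ∀ j ≤ m, 0 < ε j := by
    intro j
    induction j with
    | zero => exact fun _ => hε₀
    | succ n ih =>
      intro hn
      exact (ih (by omega)).trans (hεmono (n + 1) (by omega) hn)
  have herr : ∀ j ≤ m, ε j * |(∑ i ∈ Finset.range (j + 1), lam i) - ω| < δ := by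
    intro j
    induction j with
    | zero =>
      intro _
      have hω : |ω| ≤ N / 2 := abs_le.mpr ⟨hω₁, hω₂.le⟩
      have hy : |ε 0 * ω| ≤ (1 - 2 * δ) / 2 := by
        rw [le_div_iff₀ hN] at hε₀N
        rw [abs_mul, abs_of_pos hε₀]
        have := mul_le_mul_of_nonneg_left hω hε₀.le
        linarith
      have h := abs_modHalf_sub_lt hy (hb 0 (Nat.zero_le m))
      rwa [show modHalf (b 0) - ε 0 * ω = ε 0 * (lam 0 - ω) by rw [hlam₀]; field_simp,
        abs_mul, abs_of_pos hε₀, ← Finset.sum_range_one lam] at h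
    | succ n ih =>
      intro hn
      have hεn := hpos n (by omega)
      have hεn' := hpos (n + 1) hn
      have hprev := ih (by omega)
      have hratio := hβ (n + 1) (by omega) hn
      rw [Nat.add_sub_cancel] at hratio
      set S := ∑ i ∈ Finset.range (n + 1), lam i with hS
      have hy : |ε (n + 1) * (ω - S)| ≤ (1 - 2 * δ) / 2 := by
        calc |ε (n + 1) * (ω - S)| = ε (n + 1) / ε n * (ε n * |S - ω|) := by
              rw [abs_mul, abs_of_pos hεn', abs_sub_comm]
              field_simp
          _ ≤ (1 - 2 * δ) / (2 * δ) * δ := by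
              gcongr
              exact div_nonneg (by linarith) (by linarith)
          _ = (1 - 2 * δ) / 2 := by field_simp
      have h := abs_modHalf_sub_lt (c := b (n + 1) - ε (n + 1) * S) hy
        (by convert hb (n + 1) hn using 2; ring)
      have hupdate : modHalf (b (n + 1) - ε (n + 1) * S) - ε (n + 1) * (ω - S) =
          ε (n + 1) * (S + lam (n + 1) - ω) := by
        rw [hlam (n + 1) (by omega) hn, ← hS]
        field_simp
        ring
      rwa [hupdate, abs_mul, abs_of_pos hεn', hS, ← Finset.sum_range_succ] at h
  rw [div_mul_prod_ratio_inv δ ε m fun j hj => (hpos j hj).ne', le_div_iff₀ (hpos m le_rfl),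
    mul_comm]
  exact (herr m le_rfl).le
end

section
/- Let N > 0, ω ∈ [−N/2, N/2), 0 < δ ≤ 1/4, 1 < β ≤ (1 − 2δ)/(2δ), and 0 < ε_0 ≤ (1 − 2δ)/N, and set ε_j = β^j ε_0 for 0 ≤ j ≤ m. Suppose b_0, …, b_m ∈ ℝ satisfy ‖ε_j ω − b_j‖_ℤ < δ for all 0 ≤ j ≤ m, and define recursively λ_0 = (b_0 mod [−1/2, 1/2))/ε_0 and, for 1 ≤ j ≤ m, λ_j = ((b_j − ε_j(λ_0 + ⋯ + λ_{j−1})) mod [−1/2, 1/2))/ε_j, and set ω̃ = λ_0 + ⋯ + λ_m. Let p > 0 and suppose m ≥ ⌊log_β(2δ/(p ε_0))⌋ + 1. Then |ω̃ − ω| ≤ (δ/ε_0) β^{−m} < p/2. -/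
theorem modHalf_sub_intCast_of_abs_lt {y : ℝ} {k : ℤ} (h : |y - k| < 1 / 2) :
    modHalf y = y - k := by
  obtain ⟨h₁, h₂⟩ := abs_lt.mp h
  have hfract : Int.fract (y + 1 / 2) = y + 1 / 2 - k :=
    Int.fract_eq_iff.mpr ⟨by linarith, by linarith, k, by ring⟩
  rw [modHalf, hfract]
  ring

/-- If `b` approximates `x` modulo `1` up to `δ`, and `x` is at distance at least `δ` from
the ends of `[-1/2, 1/2)`, then `modHalf b` approximates `x` up to `δ`. -/
theorem abs_modHalf_sub_lt_s1 {x b δ : ℝ} (hx : |x| ≤ 1 / 2 - δ) (hb : leeNorm (x - b) < δ) :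
    |modHalf b - x| < δ := by
  obtain ⟨k, hk⟩ := exists_lt_of_ciInf_lt hb
  obtain ⟨h₁, h₂⟩ := abs_lt.mp hk
  obtain ⟨h₃, h₄⟩ := abs_le.mp hx
  have hmod : modHalf b = b - (-k : ℤ) := by
    apply modHalf_sub_intCast_of_abs_lt
    push_cast
    exact abs_lt.mpr ⟨by linarith, by linarith⟩
  rw [hmod]
  push_cast
  exact abs_lt.mpr ⟨by linarith, by linarith⟩

/-- Corollary 4.3: with geometric shifts `ε j = β^j * ε₀`, `β ≤ (1-2δ)/(2δ)`,
`ε₀ ≤ (1-2δ)/N`, and `m ≥ ⌊log_β (2δ/(p ε₀))⌋ + 1` for some `p > 0`, the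
multiscale estimate `ω̃ = λ 0 + ⋯ + λ m` satisfies
`|ω̃ - ω| ≤ (δ/ε₀) β^{-m} < p/2`. -/
theorem multiscale_estimate_geometric (N : ℝ) (hN : 0 < N) (ω : ℝ)
    (hω₁ : -(N/2) ≤ ω) (hω₂ : ω < N/2)
    (δ : ℝ) (hδ₀ : 0 < δ) (hδ₁ : δ ≤ 1/4)
    (β : ℝ) (hβ₁ : 1 < β) (hβ₂ : β ≤ (1 - 2 * δ) / (2 * δ))
    (ε₀ : ℝ) (hε₀ : 0 < ε₀) (hε₀N : ε₀ ≤ (1 - 2 * δ) / N)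
    (m : ℕ) (ε b : ℕ → ℝ)
    (hε : ∀ j ≤ m, ε j = β ^ j * ε₀)
    (hb : ∀ j ≤ m, leeNorm (ε j * ω - b j) < δ)
    (lam : ℕ → ℝ)
    (hlam₀ : lam 0 = modHalf (b 0) / ε 0)
    (hlam : ∀ j, 1 ≤ j → j ≤ m →
      lam j = modHalf (b j - ε j * ∑ i ∈ Finset.range j, lam i) / ε j)
    (p : ℝ) (hp : 0 < p)
    (hm : ⌊Real.logb β (2 * δ / (p * ε₀))⌋ + 1 ≤ (m : ℤ)) :
    |(∑ j ∈ Finset.range (m + 1), lam j) - ω| ≤ (δ / ε₀) * β ^ (-(m : ℤ)) ∧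
      (δ / ε₀) * β ^ (-(m : ℤ)) < p / 2 := by
  have hβ₀ : 0 < β := one_pos.trans hβ₁
  have hεpos : ∀ j ≤ m, 0 < ε j := fun j hj => by rw [hε j hj]; positivity
  have hβδ : β * δ ≤ 1 / 2 - δ := by
    rw [le_div_iff₀ (by positivity)] at hβ₂
    linarith
  have herr : ∀ j ≤ m, |ε j * ((∑ i ∈ Finset.range (j + 1), lam i) - ω)| < δ := by
    intro j
    induction j with
    | zero =>
      intro hj
      have hω : |ω| ≤ N / 2 := abs_le.mpr ⟨hω₁, hω₂.le⟩
      have hε₀ω : |ε 0 * ω| ≤ 1 / 2 - δ := by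
        rw [abs_mul, abs_of_pos (hεpos 0 hj), hε 0 hj, pow_zero, one_mul]
        rw [le_div_iff₀ hN] at hε₀N
        calc ε₀ * |ω| ≤ ε₀ * (N / 2) := by gcongr
          _ ≤ 1 / 2 - δ := by linarith
      have h := abs_modHalf_sub_lt_s1 hε₀ω (hb 0 hj)
      rwa [zero_add, Finset.sum_range_one, mul_sub, hlam₀, mul_div_cancel₀ _ (hεpos 0 hj).ne']
    | succ j ih =>
      intro hj
      have hprev := ih (by omega)
      have hpos := hεpos (j + 1) hj
      set S := ∑ i ∈ Finset.range (j + 1), lam i with hS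
      have hstep : ε (j + 1) = β * ε j := by
        rw [hε _ hj, hε j (by omega)]
        ring
      have hres : |ε (j + 1) * (ω - S)| ≤ 1 / 2 - δ := by
        calc |ε (j + 1) * (ω - S)| = β * |ε j * (S - ω)| := by
              rw [hstep, mul_assoc, abs_mul, abs_of_pos hβ₀, abs_mul, abs_mul, abs_sub_comm]
          _ ≤ β * δ := by gcongr
          _ ≤ 1 / 2 - δ := hβδ
      have hlee : leeNorm (ε (j + 1) * (ω - S) - (b (j + 1) - ε (j + 1) * S)) < δ := by
        convert hb (j + 1) hj using 2
        ring
      have h := abs_modHalf_sub_lt_s1 hres hlee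
      have hmul : ε (j + 1) * lam (j + 1) = modHalf (b (j + 1) - ε (j + 1) * S) := by
        rw [hlam (j + 1) (by omega) hj, mul_div_cancel₀ _ hpos.ne']
      rw [Finset.sum_range_succ, ← hS]
      rw [← hmul] at h
      convert h using 2
      ring
  constructor
  · have h := herr m le_rfl
    rw [abs_mul, abs_of_pos (hεpos m le_rfl), hε m le_rfl] at h
    rw [zpow_neg, zpow_natCast, ← div_eq_mul_inv, div_div, le_div_iff₀ (by positivity)]
    linarith
  · have hlog : Real.logb β (2 * δ / (p * ε₀)) < (m : ℝ) := by
      exact_mod_cast Int.floor_lt.mp (Int.lt_of_add_one_le hm)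
    rw [Real.logb_lt_iff_lt_rpow hβ₁ (by positivity), Real.rpow_natCast,
      div_lt_iff₀ (by positivity)] at hlog
    rw [zpow_neg, zpow_natCast, ← div_eq_mul_inv, div_div, div_lt_iff₀ (by positivity)]
    linarith
end

section
/- Let S(t) = ∑_{ω∈Ω} a_ω e^{2πiωt} with Ω a finite set of integers, a_ω ∈ ℂ, let N be a positive real number with Ω ⊆ (−N/2, N/2), let p be a positive integer, and let 0 < ε ≤ 1/N. Suppose ω ∈ Ω has a_ω ≠ 0 and has no collision modulo p (there is no other ω' ∈ Ω with ω' ≡ ω (mod p)), and let h = ω mod p. Then ω is completely determined by the reconstruction formula ω = (1/(2πε)) · Arg(Ŝ_{p,ε}[h]/Ŝ_p[h]). -/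
open Complex Finset

/-- The geometric sum of the `p`-th root of unity `e^{2πim/p}` vanishes unless `p ∣ m`. -/
theorem sum_exp_two_pi_mul_I_pow (p : ℕ) (hp : 0 < p) (m : ℤ) :
    ∑ j ∈ Finset.range p, Complex.exp (2 * Real.pi * Complex.I * m / p) ^ j =
      if (p : ℤ) ∣ m then (p : ℂ) else 0 := by
  have hp0 : (p : ℂ) ≠ 0 := by exact_mod_cast hp.ne'
  have hpi : (2 * Real.pi * Complex.I : ℂ) ≠ 0 := Complex.two_pi_I_ne_zero
  split_ifs with hm
  · obtain ⟨k, rfl⟩ := hm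
    have h1 : Complex.exp (2 * Real.pi * Complex.I * ((p * k : ℤ) : ℂ) / p) = 1 := by
      rw [Complex.exp_eq_one_iff]
      refine ⟨k, ?_⟩
      push_cast
      field_simp
    simp only [h1, one_pow, Finset.sum_const, Finset.card_range, nsmul_eq_mul, mul_one]
  · have hz : Complex.exp (2 * Real.pi * Complex.I * m / p) ≠ 1 := by
      rw [Ne, Complex.exp_eq_one_iff]
      rintro ⟨k, hk⟩
      apply hm
      refine ⟨k, ?_⟩
      rw [div_eq_iff hp0] at hk
      have : (m : ℂ) = p * k := by
        apply mul_left_cancel₀ hpi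
        rw [hk]
        ring
      exact_mod_cast this
    have hzp : Complex.exp (2 * Real.pi * Complex.I * m / p) ^ p = 1 := by
      rw [← Complex.exp_nat_mul, Complex.exp_eq_one_iff]
      refine ⟨m, ?_⟩
      field_simp
    rw [geom_sum_eq hz, hzp, sub_self, zero_div]

/-- At the residue of a frequency `ω` without collision modulo `p`, the DFT of the samples
shifted by `δ` isolates the term of frequency `ω`. -/
theorem dft_shifted_samples_of_no_collision (Ω : Finset ℤ) (a : ℤ → ℂ) (S : ℝ → ℂ)
    (hS : ∀ t : ℝ, S t = ∑ ω' ∈ Ω, a ω' * Complex.exp (2 * Real.pi * Complex.I * ω' * t))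
    (p : ℕ) (hp : 0 < p) (δ : ℝ) (ω : ℤ) (hω : ω ∈ Ω)
    (hnc : ∀ ω' ∈ Ω, ω' ≠ ω → ¬ ((p : ℤ) ∣ (ω' - ω)))
    (h : ℤ) (hh : h = ω % (p : ℤ)) :
    ∑ j ∈ Finset.range p, S ((j : ℝ) / p + δ) *
        Complex.exp (-(2 * Real.pi * Complex.I * j * h / p)) =
      p * (a ω * Complex.exp (2 * Real.pi * Complex.I * ω * δ)) := by
  have hdvd : (p : ℤ) ∣ ω - h := hh ▸ Int.dvd_self_sub_emod
  have hterm : ∀ ω' ∈ Ω, ∑ j ∈ Finset.range p,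
      a ω' * Complex.exp (2 * Real.pi * Complex.I * ω' * (((j : ℝ) / p + δ : ℝ) : ℂ)) *
        Complex.exp (-(2 * Real.pi * Complex.I * j * h / p)) =
      a ω' * Complex.exp (2 * Real.pi * Complex.I * ω' * δ) *
        if (p : ℤ) ∣ ω' - h then (p : ℂ) else 0 := by
    intro ω' _
    rw [← sum_exp_two_pi_mul_I_pow p hp, Finset.mul_sum]
    refine Finset.sum_congr rfl fun j _ => ?_
    rw [← Complex.exp_nat_mul, mul_assoc (a ω'), mul_assoc (a ω'), ← Complex.exp_add,
      ← Complex.exp_add]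
    congr 2
    push_cast
    ring
  simp_rw [hS, Finset.sum_mul]
  rw [Finset.sum_comm, Finset.sum_congr rfl hterm, Finset.sum_eq_single_of_mem ω hω]
  · rw [if_pos hdvd, mul_comm]
  · intro ω' hω' hne
    rw [if_neg, mul_zero]
    intro hd
    apply hnc ω' hω' hne
    simpa using dvd_sub hd hdvd

/-- For a frequency-sparse signal `S(t) = ∑_{ω ∈ Ω} a_ω e^{2πiωt}` with
`Ω ⊆ (-N/2, N/2)`, a positive integer `p`, and a shift `0 < ε ≤ 1/N`: if
`ω ∈ Ω` has `a_ω ≠ 0` and no collision modulo `p`, then with `h = ω mod p` the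
frequency is completely determined by
`ω = (1/(2πε)) · Arg(Ŝ_{p,ε}[h] / Ŝ_p[h])`. -/
theorem frequency_reconstruction (Ω : Finset ℤ) (a : ℤ → ℂ) (S : ℝ → ℂ)
    (hS : ∀ t : ℝ, S t = ∑ ω' ∈ Ω, a ω' * Complex.exp (2 * Real.pi * Complex.I * ω' * t))
    (N : ℝ) (hN : 0 < N)
    (hΩ : ∀ ω' ∈ Ω, -(N/2) < (ω' : ℝ) ∧ (ω' : ℝ) < N/2)
    (p : ℕ) (hp : 0 < p)
    (ε : ℝ) (hε₀ : 0 < ε) (hε₁ : ε ≤ 1 / N)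
    (ω : ℤ) (hω : ω ∈ Ω) (ha : a ω ≠ 0)
    (hnc : ∀ ω' ∈ Ω, ω' ≠ ω → ¬ ((p : ℤ) ∣ (ω' - ω)))
    (h : ℤ) (hh : h = ω % (p : ℤ))
    (Shat ShatEps : ℤ → ℂ)
    (hShat : ∀ h' : ℤ, Shat h' = ∑ j ∈ Finset.range p, S ((j : ℝ) / p) *
        Complex.exp (-(2 * Real.pi * Complex.I * j * h' / p)))
    (hShatEps : ∀ h' : ℤ, ShatEps h' = ∑ j ∈ Finset.range p, S ((j : ℝ) / p + ε) *
        Complex.exp (-(2 * Real.pi * Complex.I * j * h' / p))) :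
    (ω : ℝ) = (1 / (2 * Real.pi * ε)) * Complex.arg (ShatEps h / Shat h) := by
  have hp0 : (p : ℂ) ≠ 0 := by exact_mod_cast hp.ne'
  have hbase := dft_shifted_samples_of_no_collision Ω a S hS p hp 0 ω hω hnc h hh
  simp only [add_zero, Complex.ofReal_zero, mul_zero, Complex.exp_zero, mul_one] at hbase
  have hratio : ShatEps h / Shat h =
      Complex.exp (((2 * Real.pi * ε * ω : ℝ) : ℂ) * Complex.I) := by
    rw [hShat, hShatEps, hbase,
      dft_shifted_samples_of_no_collision Ω a S hS p hp ε ω hω hnc h hh,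
      ← mul_assoc, mul_div_cancel_left₀ _ (mul_ne_zero hp0 ha)]
    congr 1
    push_cast
    ring
  obtain ⟨hlo, hhi⟩ := hΩ ω hω
  have hεN : ε * N ≤ 1 := (le_div_iff₀ hN).mp hε₁
  have hlow : -1 < 2 * (ε * ω) := by nlinarith
  have hhigh : 2 * (ε * ω) < 1 := by nlinarith
  have hpi := Real.pi_pos
  rw [hratio, Complex.arg_exp_mul_I, (toIocMod_eq_self _).mpr]
  · field_simp
  · constructor <;> nlinarith
end

section
/- Let S(t) = ∑_{ω∈Ω} a_ω e^{2πiωt} with Ω a finite set of integers, a_ω ∈ ℂ, let L be a positive real number, and let p be a positive integer. Suppose ω ∈ Ω satisfies |ω| < L/2, has a_ω ≠ 0, and has no collision modulo p (there is no other ω' ∈ Ω with ω' ≡ ω (mod p)), and let h = ω mod p. Then for any 0 < ε ≤ 1/L the reconstruction formula ω = (1/(2πε)) · Arg(Ŝ_{p,ε}[h]/Ŝ_p[h]) holds. -/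
open Complex Finset

/-- The geometric sum of the additive character `j ↦ exp (2πinj/p)` over a full period. -/
theorem sum_range_exp_two_pi_mul_I (p : ℕ) (hp : 0 < p) (n : ℤ) :
    ∑ j ∈ Finset.range p, Complex.exp (2 * Real.pi * Complex.I * n * j / p) =
      if (p : ℤ) ∣ n then (p : ℂ) else 0 := by
  have hζ := Complex.isPrimitiveRoot_exp p hp.ne'
  set ζ := Complex.exp (2 * Real.pi * Complex.I / p) with hζdef
  have hterm : ∀ j : ℕ, Complex.exp (2 * Real.pi * Complex.I * n * j / p) = (ζ ^ n) ^ j := by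
    intro j
    rw [hζdef, ← Complex.exp_int_mul, ← Complex.exp_nat_mul]
    congr 1
    ring
  simp only [hterm]
  split_ifs with hdvd
  · rw [(hζ.zpow_eq_one_iff_dvd n).2 hdvd]
    simp
  · have hne : ζ ^ n ≠ 1 := fun h => hdvd ((hζ.zpow_eq_one_iff_dvd n).1 h)
    have hpow : (ζ ^ n) ^ p = 1 := by
      rw [← zpow_natCast, zpow_comm, zpow_natCast, hζ.pow_eq_one, one_zpow]
    rw [geom_sum_eq hne, hpow, sub_self, zero_div]

/-- The DFT of the shifted samples of a trigonometric polynomial, at the residue of a frequency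
without collisions, recovers the modulated coefficient of that frequency. -/
theorem dft_shifted_samples_eq (Ω : Finset ℤ) (a : ℤ → ℂ) (p : ℕ) (hp : 0 < p) (ω : ℤ)
    (hω : ω ∈ Ω) (hnc : ∀ ω' ∈ Ω, ω' ≠ ω → ¬ ((p : ℤ) ∣ (ω' - ω))) (ε : ℝ) :
    ∑ j ∈ Finset.range p,
        (∑ ω' ∈ Ω, a ω' * Complex.exp (2 * Real.pi * Complex.I * ω' * ((j : ℝ) / p + ε : ℝ))) *
          Complex.exp (-(2 * Real.pi * Complex.I * j * (ω % (p : ℤ) : ℤ) / p)) =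
      p * a ω * Complex.exp (2 * Real.pi * Complex.I * ω * ε) := by
  have hpC : (p : ℂ) ≠ 0 := Nat.cast_ne_zero.2 hp.ne'
  simp_rw [Finset.sum_mul]
  rw [Finset.sum_comm]
  have hinner : ∀ ω' ∈ Ω, ∑ j ∈ Finset.range p,
      a ω' * Complex.exp (2 * Real.pi * Complex.I * ω' * ((j : ℝ) / p + ε : ℝ)) *
        Complex.exp (-(2 * Real.pi * Complex.I * j * (ω % (p : ℤ) : ℤ) / p)) =
      a ω' * Complex.exp (2 * Real.pi * Complex.I * ω' * ε) *
        if (p : ℤ) ∣ ω' - ω % (p : ℤ) then (p : ℂ) else 0 := by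
    intro ω' _
    rw [← sum_range_exp_two_pi_mul_I p hp, Finset.mul_sum]
    refine Finset.sum_congr rfl fun j _ => ?_
    rw [mul_assoc (a ω'), mul_assoc (a ω'), ← Complex.exp_add, ← Complex.exp_add]
    congr 2
    push_cast
    field_simp
    ring
  have hdvd : ∀ ω' : ℤ, (p : ℤ) ∣ ω' - ω % (p : ℤ) ↔ (p : ℤ) ∣ ω' - ω := by
    intro ω'
    have hmod : (p : ℤ) ∣ ω - ω % (p : ℤ) := Int.dvd_self_sub_emod
    rw [← sub_add_sub_cancel ω' ω (ω % (p : ℤ))]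
    exact (dvd_add_left hmod)
  rw [Finset.sum_congr rfl hinner, Finset.sum_eq_single_of_mem ω hω]
  · rw [if_pos ((hdvd ω).2 (by simp))]
    ring
  · intro ω' hω' hne
    rw [if_neg (mt (hdvd ω').1 (hnc ω' hω' hne)), mul_zero]

/-- For a frequency-sparse signal `S(t) = ∑_{ω ∈ Ω} a_ω e^{2πiωt}`, a positive
real `L`, and a positive integer `p`: if `ω ∈ Ω` satisfies `|ω| < L/2`, has
`a_ω ≠ 0`, and has no collision modulo `p`, then with `h = ω mod p`, for any
`0 < ε ≤ 1/L` the reconstruction formula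
`ω = (1/(2πε)) · Arg(Ŝ_{p,ε}[h] / Ŝ_p[h])` holds. -/
theorem frequency_reconstruction_general (Ω : Finset ℤ) (a : ℤ → ℂ) (S : ℝ → ℂ)
    (hS : ∀ t : ℝ, S t = ∑ ω' ∈ Ω, a ω' * Complex.exp (2 * Real.pi * Complex.I * ω' * t))
    (L : ℝ) (hL : 0 < L)
    (p : ℕ) (hp : 0 < p)
    (ω : ℤ) (hω : ω ∈ Ω) (hωL : |(ω : ℝ)| < L / 2) (ha : a ω ≠ 0)
    (hnc : ∀ ω' ∈ Ω, ω' ≠ ω → ¬ ((p : ℤ) ∣ (ω' - ω)))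
    (h : ℤ) (hh : h = ω % (p : ℤ))
    (Shat : ℤ → ℂ) (ShatEps : ℝ → ℤ → ℂ)
    (hShat : ∀ h' : ℤ, Shat h' = ∑ j ∈ Finset.range p, S ((j : ℝ) / p) *
        Complex.exp (-(2 * Real.pi * Complex.I * j * h' / p)))
    (hShatEps : ∀ (ε : ℝ) (h' : ℤ), ShatEps ε h' = ∑ j ∈ Finset.range p,
        S ((j : ℝ) / p + ε) * Complex.exp (-(2 * Real.pi * Complex.I * j * h' / p))) :
    ∀ ε : ℝ, 0 < ε → ε ≤ 1 / L →
      (ω : ℝ) = (1 / (2 * Real.pi * ε)) * Complex.arg (ShatEps ε h / Shat h) := by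
  intro ε hε hεL
  have hpC : (p : ℂ) ≠ 0 := Nat.cast_ne_zero.2 hp.ne'
  have hshift : ShatEps ε h = p * a ω * Complex.exp (2 * Real.pi * Complex.I * ω * ε) := by
    rw [hShatEps, hh, ← dft_shifted_samples_eq Ω a p hp ω hω hnc ε]
    simp only [hS]
  have hbase : Shat h = p * a ω := by
    have h0 := dft_shifted_samples_eq Ω a p hp ω hω hnc 0
    simp only [add_zero, Complex.ofReal_zero, mul_zero, Complex.exp_zero, mul_one] at h0
    rw [hShat, hh, ← h0]
    simp only [hS]
  have hquot : ShatEps ε h / Shat h = Complex.exp ((2 * Real.pi * ω * ε : ℝ) * Complex.I) := by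
    rw [hshift, hbase, mul_div_cancel_left₀ _ (mul_ne_zero hpC ha)]
    congr 1
    push_cast
    ring
  have hsmall : |(ω : ℝ) * ε| < 1 / 2 := by
    rw [abs_mul, abs_of_pos hε]
    calc |(ω : ℝ)| * ε < L / 2 * ε := by gcongr
      _ ≤ L / 2 * (1 / L) := by gcongr
      _ = 1 / 2 := by field_simp
  obtain ⟨hlow, hupp⟩ := abs_lt.1 hsmall
  have harg : Complex.arg (ShatEps ε h / Shat h) = 2 * Real.pi * ω * ε := by
    rw [hquot, Complex.arg_exp_mul_I, toIocMod_eq_self]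
    constructor <;> nlinarith [Real.pi_pos]
  rw [harg]
  field_simp
end
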